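/- Let G be a brick that is Birkhoff–von Neumann, and let e be an edge of G such that the face F = {x ∈ PM(G) : x_e = 0} is nonempty with the dimension of its affine span equal to the dimension of the affine span of PM(G) minus 1. Then either (a) the graph G − e is matching covered, or (b) there exists a unique edge e' ≠ e of G such that G − e − e' is bipartite and every perfect matching of G contains e if and only if it contains e'. -/

import Mathlib

open BigOperators

variable {V : Type*}

/-- A graph is matching covered if it is connected, has an edge, and every edge
lies in some perfect matching. -/
def MatchingCovered (G : SimpleGraph V) : Prop :=
  G.Connected ∧ G.edgeSet.Nonempty ∧
    ∀ e ∈ G.edgeSet, ∃ M : G.Subgraph, M.IsPerfectMatching ∧ e ∈ M.edgeSet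

/-- The cut `δ(U)`: edges of `G` with exactly one endpoint in `U`. -/
def cutSet (G : SimpleGraph V) (U : Set V) : Set (Sym2 V) :=
  {e | e ∈ G.edgeSet ∧ ∃ a b, e = s(a, b) ∧ a ∈ U ∧ b ∉ U}

/-- `U` is the shore of an odd cut: both `U` and its complement have odd size. -/
def IsOddCutShore [Fintype V] (U : Set V) : Prop := Odd U.ncard ∧ Odd Uᶜ.ncard

/-- `δ(U)` is a tight cut: an odd cut met exactly once by every perfect matching. -/
def IsTightCut [Fintype V] (G : SimpleGraph V) (U : Set V) : Prop :=
  IsOddCutShore U ∧ ∀ M : G.Subgraph, M.IsPerfectMatching →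
    (M.edgeSet ∩ cutSet G U).ncard = 1

/-- A brick: a non-bipartite matching covered graph with no nontrivial tight cut. -/
def IsBrick [Fintype V] (G : SimpleGraph V) : Prop :=
  MatchingCovered G ∧ ¬ G.Colorable 2 ∧
    ∀ U : Set V, IsTightCut G U → ¬(2 ≤ U.ncard ∧ 2 ≤ Uᶜ.ncard)

open Classical in
/-- The incidence vector (over `ℝ`) of the edge set of a subgraph `M` of `G`. -/
noncomputable def incVecR (G : SimpleGraph V) (M : G.Subgraph) : Sym2 V → ℝ :=
  fun e => if e ∈ M.edgeSet then (1 : ℝ) else 0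

/-- The perfect matching polytope: convex hull of incidence vectors of perfect
matchings. -/
def pmPolytope (G : SimpleGraph V) : Set (Sym2 V → ℝ) :=
  convexHull ℝ {x | ∃ M : G.Subgraph, M.IsPerfectMatching ∧ x = incVecR G M}

/-- The bipartite relaxation `P(G)`: nonnegative vectors supported on the edges
of `G` whose sum over the edges at each vertex is `1`. -/
def bipRelaxation [Fintype V] [DecidableEq V] (G : SimpleGraph V) : Set (Sym2 V → ℝ) :=
  {x | (∀ e, 0 ≤ x e) ∧ (∀ e, e ∉ G.edgeSet → x e = 0) ∧
    ∀ v : V, ∑ e ∈ Finset.univ.filter (fun e : Sym2 V => v ∈ e), x e = 1}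

/-- A matching covered graph is Birkhoff–von Neumann if its perfect matching
polytope equals its bipartite relaxation. -/
def IsBvN [Fintype V] [DecidableEq V] (G : SimpleGraph V) : Prop :=
  pmPolytope G = bipRelaxation G

/-- The dimension of the affine span of a subset of `ℝ^{Sym2 V}`. -/
noncomputable def affDim (s : Set (Sym2 V → ℝ)) : ℕ :=
  Module.finrank ℝ (affineSpan ℝ s).direction

section Helpers

theorem pm_exists_unique {G : SimpleGraph V} {M : G.Subgraph} (hM : M.IsPerfectMatching) (v : V) :
    ∃! w, M.Adj v w :=
  SimpleGraph.Subgraph.isPerfectMatching_iff.mp hM v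

/-- A set closed under the partner map of a perfect matching has even size. -/
theorem even_of_closed [Fintype V] {G : SimpleGraph V} {M : G.Subgraph}
    (hM : M.IsPerfectMatching) (Y : Set V)
    (hY : ∀ u v, u ∈ Y → M.Adj u v → v ∈ Y) : Even Y.ncard := by
  classical
  have h : (M.induce Y).IsMatching := by
    intro v hv
    have hv' : v ∈ Y := by simpa using hv
    obtain ⟨w, hw, hu⟩ := pm_exists_unique hM v
    refine ⟨w, ?_, ?_⟩
    · simp [SimpleGraph.Subgraph.induce, hv', hY v w hv' hw, hw]
    · intro y hy
      simp only [SimpleGraph.Subgraph.induce_adj] at hy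
      exact hu y hy.2.2
  have h2 := h.even_card
  rw [Set.ncard_eq_toFinset_card']
  convert h2 using 2
  ext x
  simp

/-- A connected graph has an edge leaving every proper nonempty vertex set. -/
theorem exists_crossing {G : SimpleGraph V} (hG : G.Connected) (X : Set V) {x y : V}
    (hx : x ∈ X) (hy : y ∉ X) : ∃ u v, u ∈ X ∧ v ∉ X ∧ G.Adj u v := by
  obtain ⟨p⟩ := hG.preconnected x y
  obtain ⟨d, _, h1, h2⟩ := p.exists_boundary_dart X hx hy
  exact ⟨d.fst, d.snd, h1, h2, d.adj⟩

/-- The tight cut obtained from a two-edge cut with equivalent edges. -/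
theorem two_cut_aux [Fintype V] (G : SimpleGraph V) (hB : IsBrick G) (X : Set V)
    {a b c d : V} (ha : a ∈ X) (hc : c ∈ X) (hb : b ∉ X) (hac : a ≠ c)
    (hcut : ∀ u v, u ∈ X → v ∉ X → G.Adj u v → (u = a ∧ v = b) ∨ (u = c ∧ v = d))
    (hd : d ∉ X)
    (heq : ∀ M : G.Subgraph, M.IsPerfectMatching → (M.Adj a b ↔ M.Adj c d))
    (M0 : G.Subgraph) (hM0 : M0.IsPerfectMatching) (hM0a : ¬ M0.Adj a b) :
    ∀ v ∈ X, v = a ∨ v = c := by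
  classical
  have hXe : Even X.ncard := by
    apply even_of_closed hM0
    intro u v hu huv
    by_contra hv
    rcases hcut u v hu hv huv.adj_sub with ⟨rfl, rfl⟩ | ⟨rfl, rfl⟩
    · exact hM0a huv
    · exact hM0a ((heq M0 hM0).2 huv)
  have hVe : Even (Set.univ : Set V).ncard := even_of_closed hM0 _ (by simp)
  have hUX : (X \ {a}).ncard + 1 = X.ncard := Set.ncard_sdiff_singleton_add_one ha
  have hcompl : (X \ {a}).ncard + (X \ {a})ᶜ.ncard = (Set.univ : Set V).ncard := by
    rw [Set.ncard_add_ncard_compl, Set.ncard_univ]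
  have htight : IsTightCut G (X \ {a}) := by
    refine ⟨⟨?_, ?_⟩, ?_⟩
    · grind
    · grind
    · intro M hM
      rw [Set.ncard_eq_one]
      by_cases hab : M.Adj a b
      · have hcd := (heq M hM).1 hab
        refine ⟨s(c, d), ?_⟩
        ext g
        simp only [Set.mem_inter_iff, Set.mem_singleton_iff, cutSet, Set.mem_ofPred_eq]
        constructor
        · rintro ⟨hg, hgG, u, v, rfl, hu, hv⟩
          rw [SimpleGraph.Subgraph.mem_edgeSet] at hg
          by_cases hvX : v ∈ X
          · have : v = a := by
              by_contra h
              exact hv ⟨hvX, h⟩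
            subst this
            have := (pm_exists_unique hM v).unique hab hg.symm
            subst this
            exact absurd hu.1 hb
          · rcases hcut u v hu.1 hvX hg.adj_sub with ⟨rfl, rfl⟩ | ⟨rfl, rfl⟩
            · exact absurd rfl hu.2
            · rfl
        · rintro rfl
          exact ⟨hcd, hcd.adj_sub, c, d, rfl, ⟨hc, fun h => hac h.symm⟩, fun h => hd h.1⟩
      · have hcd : ¬ M.Adj c d := fun h => hab ((heq M hM).2 h)
        obtain ⟨p, hp, hpu⟩ := pm_exists_unique hM a
        have hpX : p ∈ X := by
          by_contra h
          rcases hcut a p ha h hp.adj_sub with ⟨_, rfl⟩ | ⟨h1, _⟩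
          · exact hab hp
          · exact hac h1
        refine ⟨s(p, a), ?_⟩
        ext g
        simp only [Set.mem_inter_iff, Set.mem_singleton_iff, cutSet, Set.mem_ofPred_eq]
        constructor
        · rintro ⟨hg, hgG, u, v, rfl, hu, hv⟩
          rw [SimpleGraph.Subgraph.mem_edgeSet] at hg
          by_cases hvX : v ∈ X
          · have : v = a := by
              by_contra h
              exact hv ⟨hvX, h⟩
            subst this
            rw [hpu u hg.symm]
          · rcases hcut u v hu.1 hvX hg.adj_sub with ⟨rfl, rfl⟩ | ⟨rfl, rfl⟩
            · exact absurd rfl hu.2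
            · exact absurd hg hcd
        · rintro rfl
          exact ⟨hp.symm, hp.symm.adj_sub, p, a, rfl, ⟨hpX, hp.adj_sub.ne'⟩, fun h => h.2 rfl⟩
  have hnt := hB.2.2 _ htight
  have hcompl2 : 2 ≤ (X \ {a})ᶜ.ncard := by
    have h1 : ({a, b} : Set V) ⊆ (X \ {a})ᶜ := by
      rintro x (rfl | rfl)
      · simp
      · simp [hb]
    have h2 := Set.ncard_le_ncard h1 (Set.toFinite _)
    rwa [Set.ncard_pair (by rintro rfl; exact hb ha)] at h2
  intro v hv
  by_contra hcon
  push Not at hcon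
  apply hnt
  refine ⟨?_, hcompl2⟩
  have h1 : ({c, v} : Set V) ⊆ X \ {a} := by
    rintro x (rfl | rfl)
    · exact ⟨hc, fun h => hac h.symm⟩
    · exact ⟨hv, hcon.1⟩
  have h2 := Set.ncard_le_ncard h1 (Set.toFinite _)
  rwa [Set.ncard_pair (Ne.symm hcon.2)] at h2

/-- A brick has no two-edge cut whose two edges lie in the same perfect matchings. -/
theorem no_two_cut [Fintype V] (G : SimpleGraph V) (hB : IsBrick G) (X : Set V)
    {a b c d : V} (ha : a ∈ X) (hc : c ∈ X) (hb : b ∉ X) (hd : d ∉ X)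
    (hab : G.Adj a b) (hne : s(a, b) ≠ s(c, d))
    (hcut : ∀ u v, u ∈ X → v ∉ X → G.Adj u v → (u = a ∧ v = b) ∨ (u = c ∧ v = d))
    (heq : ∀ M : G.Subgraph, M.IsPerfectMatching → (M.Adj a b ↔ M.Adj c d))
    (M0 : G.Subgraph) (hM0 : M0.IsPerfectMatching) (hM0a : ¬ M0.Adj a b) : False := by
  classical
  obtain ⟨M1, hM1, h1⟩ := hB.1.2.2 s(a, b) hab
  rw [SimpleGraph.Subgraph.mem_edgeSet] at h1
  have h1' := (heq M1 hM1).1 h1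
  have hac : a ≠ c := by
    rintro rfl
    exact hne (by rw [(pm_exists_unique hM1 a).unique h1 h1'])
  have hbd : b ≠ d := by
    rintro rfl
    exact hne (by rw [(pm_exists_unique hM1 b).unique h1.symm h1'.symm])
  have hX := two_cut_aux G hB X ha hc hb hac hcut hd heq M0 hM0 hM0a
  have hXc := two_cut_aux G hB Xᶜ (a := b) (b := a) (c := d) (d := c) hb hd (by simpa using ha) hbd
    (by
      intro u v hu hv huv
      have := hcut v u (by simpa using hv) hu huv.symm
      tauto)
    (by simpa using hc)
    (fun M hM => by rw [M.adj_comm b a, M.adj_comm d c]; exact heq M hM) M0 hM0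
    (fun h => hM0a h.symm)
  apply hB.2.1
  refine ⟨SimpleGraph.Coloring.mk (fun v => if v = a ∨ v = d then (0 : Fin 2) else 1) ?_⟩
  intro u v huv
  have hne' := huv.ne
  have had : a ≠ d := fun h => hd (h ▸ ha)
  have hcb : c ≠ b := fun h => hb (h ▸ hc)
  have huX : u = a ∨ u = c ∨ u = b ∨ u = d := by
    by_cases h : u ∈ X
    · rcases hX u h with h | h <;> simp [h]
    · rcases hXc u h with h | h <;> simp [h]
  have hvX : v = a ∨ v = c ∨ v = b ∨ v = d := by
    by_cases h : v ∈ X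
    · rcases hX v h with h | h <;> simp [h]
    · rcases hXc v h with h | h <;> simp [h]
  have k1 := hcut u v
  have k2 := hcut v u
  have huv' := huv.symm
  have hab' : a ≠ b := fun h => hb (h ▸ ha)
  have hcd' : c ≠ d := fun h => hd (h ▸ hc)
  grind

/-- Sum of an edge-wise function over the vertices, using the partner involution. -/
theorem sum_partner [Fintype V] {G : SimpleGraph V} {M : G.Subgraph}
    (hM : M.IsPerfectMatching) (h : V → ℝ) :
    ∃ p : V → V, (∀ v, M.Adj v (p v)) ∧ 2 * ∑ v, h v = ∑ v, (h v + h (p v)) := by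
  choose p hp hpu using fun v => pm_exists_unique hM v
  refine ⟨p, hp, ?_⟩
  have hinv : Function.Involutive p := fun v => (hpu (p v) v (hp v).symm).symm
  have := Equiv.sum_comp hinv.toPerm h
  simp only [Function.Involutive.coe_toPerm] at this
  rw [Finset.sum_add_distrib, this]
  ring

theorem incVecR_mem [Fintype V] {G : SimpleGraph V} {M : G.Subgraph}
    (hM : M.IsPerfectMatching) : incVecR G M ∈ pmPolytope G :=
  subset_convexHull ℝ _ ⟨M, hM, rfl⟩

theorem incVecR_pos {G : SimpleGraph V} {M : G.Subgraph} {g : Sym2 V} (h : g ∈ M.edgeSet) :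
    incVecR G M g = 1 := by
  simp [incVecR, h]

theorem incVecR_neg {G : SimpleGraph V} {M : G.Subgraph} {g : Sym2 V} (h : g ∉ M.edgeSet) :
    incVecR G M g = 0 := by
  simp [incVecR, h]

theorem incVecR_nonneg (G : SimpleGraph V) (M : G.Subgraph) (g : Sym2 V) :
    0 ≤ incVecR G M g := by
  by_cases h : g ∈ M.edgeSet
  · rw [incVecR_pos h]; norm_num
  · rw [incVecR_neg h]

/-- A matching covered graph has a point of `PM(G)` positive on all edges. -/
theorem exists_pos_point [Fintype V] {G : SimpleGraph V} (hG : MatchingCovered G) :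
    ∃ x ∈ pmPolytope G, ∀ g ∈ G.edgeSet, 0 < x g := by
  classical
  have hM : ∀ g : G.edgeSet, ∃ M : G.Subgraph, M.IsPerfectMatching ∧ (g : Sym2 V) ∈ M.edgeSet :=
    fun g => hG.2.2 g.1 g.2
  choose M hM1 hM2 using hM
  have : Nonempty G.edgeSet := hG.2.1.to_subtype
  have hn : (0 : ℝ) < Fintype.card G.edgeSet := by exact_mod_cast Fintype.card_pos
  refine ⟨∑ g : G.edgeSet, (1 / (Fintype.card G.edgeSet : ℝ)) • incVecR G (M g), ?_, ?_⟩
  · apply Convex.sum_mem (convex_convexHull ℝ _)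
    · intro i _
      positivity
    · simp
    · intro i _
      exact incVecR_mem (hM1 i)
  · intro g hg
    rw [Finset.sum_apply]
    apply Finset.sum_pos'
    · intro i _
      simp only [Pi.smul_apply, smul_eq_mul]
      exact mul_nonneg (by positivity) (incVecR_nonneg _ _ _)
    · refine ⟨⟨g, hg⟩, Finset.mem_univ _, ?_⟩
      simp only [Pi.smul_apply, smul_eq_mul]
      rw [incVecR_pos (hM2 ⟨g, hg⟩)]
      positivity

/-- The linear functional given by the star of `v`. -/
noncomputable def starFun [Fintype V] [DecidableEq V] (v : V) : (Sym2 V → ℝ) →ₗ[ℝ] ℝ :=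
  ∑ g ∈ Finset.univ.filter (fun g : Sym2 V => v ∈ g), LinearMap.proj g

theorem starFun_apply [Fintype V] [DecidableEq V] (v : V) (x : Sym2 V → ℝ) :
    starFun v x = ∑ g ∈ Finset.univ.filter (fun g : Sym2 V => v ∈ g), x g := by
  simp [starFun]

theorem eq_on_polytope [Fintype V] (G : SimpleGraph V) {e f : Sym2 V}
    (heq : ∀ M : G.Subgraph, M.IsPerfectMatching → (e ∈ M.edgeSet ↔ f ∈ M.edgeSet)) :
    ∀ x ∈ pmPolytope G, x e = x f := by
  intro x hx
  have h : pmPolytope G ⊆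
      (LinearMap.ker ((LinearMap.proj e : (Sym2 V → ℝ) →ₗ[ℝ] ℝ) - (LinearMap.proj f : (Sym2 V → ℝ) →ₗ[ℝ] ℝ)) :
        Set (Sym2 V → ℝ)) := by
    apply convexHull_min _ (Submodule.convex _)
    rintro _ ⟨M, hM, rfl⟩
    simp only [SetLike.mem_coe, LinearMap.mem_ker, LinearMap.sub_apply, LinearMap.proj_apply]
    by_cases he : e ∈ M.edgeSet
    · rw [incVecR_pos he, incVecR_pos ((heq M hM).1 he), sub_self]
    · rw [incVecR_neg he, incVecR_neg (fun h => he ((heq M hM).2 h)), sub_self]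
  have := h hx
  simp only [SetLike.mem_coe, LinearMap.mem_ker, LinearMap.sub_apply, LinearMap.proj_apply] at this
  linarith

/-- Duality: equivalent edges in a BvN graph give a vertex weighting. -/
theorem exists_weights [Fintype V] [DecidableEq V] (G : SimpleGraph V) (hG : MatchingCovered G)
    (hBvN : IsBvN G) {e f : Sym2 V}
    (heq : ∀ M : G.Subgraph, M.IsPerfectMatching → (e ∈ M.edgeSet ↔ f ∈ M.edgeSet)) :
    ∃ l : V → ℝ, ∀ u v, G.Adj u v →
      l u + l v = (if s(u, v) = e then 1 else 0) - (if s(u, v) = f then 1 else 0) := by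
  classical
  obtain ⟨x0, hx0, hpos⟩ := exists_pos_point hG
  have hx0' : x0 ∈ bipRelaxation G := hBvN ▸ hx0
  let L : V ⊕ {g : Sym2 V // g ∉ G.edgeSet} → ((Sym2 V → ℝ) →ₗ[ℝ] ℝ) :=
    Sum.elim starFun (fun g => (LinearMap.proj g.1 : (Sym2 V → ℝ) →ₗ[ℝ] ℝ))
  let K : (Sym2 V → ℝ) →ₗ[ℝ] ℝ := (LinearMap.proj e : (Sym2 V → ℝ) →ₗ[ℝ] ℝ) -
    (LinearMap.proj f : (Sym2 V → ℝ) →ₗ[ℝ] ℝ)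
  have hmem : K ∈ Submodule.span ℝ (Set.range L) := by
    apply mem_span_of_iInf_ker_le_ker
    intro y hy
    rw [Submodule.mem_iInf] at hy
    have hy1 : ∀ v, ∑ g ∈ Finset.univ.filter (fun g : Sym2 V => v ∈ g), y g = 0 := by
      intro v
      have := hy (Sum.inl v)
      rw [LinearMap.mem_ker] at this
      rw [← starFun_apply]
      exact this
    have hy2 : ∀ g, g ∉ G.edgeSet → y g = 0 := fun g hg => hy (Sum.inr ⟨g, hg⟩)
    have hev : ∀ᶠ t in nhdsWithin (0 : ℝ) (Set.Ioi 0), ∀ g, 0 ≤ x0 g + t * y g := by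
      rw [Filter.eventually_all]
      intro g
      by_cases hg : g ∈ G.edgeSet
      · have hc : Filter.Tendsto (fun t : ℝ => x0 g + t * y g) (nhds 0) (nhds (x0 g + 0 * y g)) :=
          Continuous.tendsto (by fun_prop) 0
        have h2 := hc.eventually (lt_mem_nhds (a := 0) (by simpa using hpos g hg))
        exact (h2.filter_mono nhdsWithin_le_nhds).mono fun t ht => ht.le
      · refine Filter.Eventually.of_forall fun t => ?_
        rw [hy2 g hg, hx0'.2.1 g hg]
        simp
    obtain ⟨t, ht1, ht0⟩ := (hev.and self_mem_nhdsWithin).exists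
    have ht0' : (0 : ℝ) < t := ht0
    have hin : (fun g => x0 g + t * y g) ∈ bipRelaxation G := by
      refine ⟨ht1, ?_, ?_⟩
      · intro g hg
        simp [hy2 g hg, hx0'.2.1 g hg]
      · intro v
        rw [Finset.sum_add_distrib, ← Finset.mul_sum, hy1 v, hx0'.2.2 v]
        simp
    rw [← hBvN] at hin
    have k1 := eq_on_polytope G heq _ hin
    have k2 := eq_on_polytope G heq _ hx0
    simp only [k2, add_right_inj] at k1
    have k3 := mul_left_cancel₀ ht0'.ne' k1
    simp [K, k3]
  rw [Submodule.mem_span_range_iff_exists_fun] at hmem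
  obtain ⟨c, hc⟩ := hmem
  refine ⟨fun v => c (Sum.inl v), fun u v huv => ?_⟩
  have h1 := LinearMap.congr_fun hc (Pi.single s(u, v) 1)
  rw [LinearMap.sum_apply, Fintype.sum_sum_type] at h1
  simp only [LinearMap.smul_apply, L, Sum.elim_inl,
    Sum.elim_inr, K, LinearMap.sub_apply, LinearMap.proj_apply, starFun_apply, smul_eq_mul,
    Pi.single_apply] at h1
  have h2 : ∀ g : {g : Sym2 V // g ∉ G.edgeSet}, (g : Sym2 V) ≠ s(u, v) := by
    rintro ⟨g, hg⟩ rfl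
    exact hg huv
  have h3 : ∀ w, (∑ g ∈ Finset.univ.filter (fun g : Sym2 V => w ∈ g),
      if g = s(u, v) then (1 : ℝ) else 0) = (if w = u then 1 else 0) + (if w = v then 1 else 0) := by
    intro w
    have := huv.ne
    rw [Finset.sum_ite_eq']
    simp only [Finset.mem_filter, Finset.mem_univ, true_and, Sym2.mem_iff]
    by_cases hu : w = u
    · subst hu; simp [this]
    · by_cases hv : w = v <;> simp [hu, hv]
      intro h; exact absurd h.symm this
  simp only [h3, h2, if_false, mul_zero, Finset.sum_const_zero, add_zero, mul_add, mul_ite, mul_one,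
    Finset.sum_add_distrib, Finset.sum_ite_eq', Finset.mem_univ, if_true] at h1
  rw [h1]
  congr 1 <;> simp [eq_comm]

/-- Equivalent edges in a BvN brick: a two-colouring in which exactly these edges are
monochromatic. -/
theorem exists_coloring [Fintype V] [DecidableEq V] (G : SimpleGraph V) (hB : IsBrick G)
    (hBvN : IsBvN G) {e f : Sym2 V} (he : e ∈ G.edgeSet) (hf : f ∈ G.edgeSet) (hne : f ≠ e)
    (heq : ∀ M : G.Subgraph, M.IsPerfectMatching → (e ∈ M.edgeSet ↔ f ∈ M.edgeSet))
    (M0 : G.Subgraph) (hM0 : M0.IsPerfectMatching) (hM0e : e ∉ M0.edgeSet) :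
    ∃ col : V → Prop, ∀ u v, G.Adj u v → ((col u ↔ col v) ↔ (s(u, v) = e ∨ s(u, v) = f)) := by
  classical
  obtain ⟨l, hl⟩ := exists_weights G hB.1 hBvN heq
  have hl0 : ∀ u v, G.Adj u v → s(u, v) ≠ e → s(u, v) ≠ f → l v = - l u := by
    intro u v h h1 h2
    have := hl u v h
    simp only [h1, h2, if_false] at this
    linarith
  obtain ⟨M1, hM1, hM1e⟩ := hB.1.2.2 e he
  have hM1f := (heq M1 hM1).1 hM1e
  have hM0f : f ∉ M0.edgeSet := fun h => hM0e ((heq M0 hM0).2 h)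
  -- odd functions of the weights sum to zero
  have hodd : ∀ φ : ℝ → ℝ, (∀ x, φ (-x) = - φ x) → ∑ v, φ (l v) = 0 := by
    intro φ hφ
    obtain ⟨p, hp, hs⟩ := sum_partner hM0 (fun v => φ (l v))
    have : ∀ v, φ (l v) + φ (l (p v)) = 0 := by
      intro v
      rw [hl0 v (p v) (hp v).adj_sub, hφ, add_neg_cancel]
      · intro h; apply hM0e; rw [← h]; exact hp v
      · intro h; apply hM0f; rw [← h]; exact hp v
    simp only [this, Finset.sum_const_zero] at hs
    linarith
  induction e using Sym2.ind with | _ a b =>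
  induction f using Sym2.ind with | _ c d =>
  rw [SimpleGraph.Subgraph.mem_edgeSet] at hM1e hM1f hM0e
  have hab : a ≠ b := hM1e.adj_sub.ne
  have hcd : c ≠ d := hM1f.adj_sub.ne
  have hac : a ≠ c := by
    rintro rfl
    exact hne (by rw [(pm_exists_unique hM1 a).unique hM1e hM1f])
  have hbd : b ≠ d := by
    rintro rfl
    exact hne (by rw [(pm_exists_unique hM1 b).unique hM1e.symm hM1f.symm])
  have had : a ≠ d := by
    rintro rfl
    exact hne (by rw [(pm_exists_unique hM1 a).unique hM1e hM1f.symm, Sym2.eq_swap])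
  have hbc : b ≠ c := by
    rintro rfl
    exact hne (by rw [(pm_exists_unique hM1 b).unique hM1e.symm hM1f, Sym2.eq_swap])
  have hla : l a + l b = 1 := by
    have := hl a b hM1e.adj_sub
    simpa [hne.symm] using this
  have hlc : l c + l d = -1 := by
    have := hl c d hM1f.adj_sub
    simpa [hne] using this
  have hfour : ∀ φ : ℝ → ℝ, (∀ x, φ (-x) = - φ x) →
      φ (l a) + φ (l b) + φ (l c) + φ (l d) = 0 := by
    intro φ hφ
    obtain ⟨p, hp, hs⟩ := sum_partner hM1 (fun v => φ (l v))
    rw [hodd φ hφ] at hs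
    have hpa : p a = b := (pm_exists_unique hM1 a).unique (hp a) hM1e
    have hpb : p b = a := (pm_exists_unique hM1 b).unique (hp b) hM1e.symm
    have hpc : p c = d := (pm_exists_unique hM1 c).unique (hp c) hM1f
    have hpd : p d = c := (pm_exists_unique hM1 d).unique (hp d) hM1f.symm
    rw [← Finset.sum_subset (Finset.subset_univ {a, b, c, d})] at hs
    · rw [Finset.sum_insert (by simp [hab, hac, had]), Finset.sum_insert (by simp [hbc, hbd]),
        Finset.sum_insert (by simp [hcd]), Finset.sum_singleton, hpa, hpb, hpc, hpd] at hs
      linarith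
    · intro v _ hv
      simp only [Finset.mem_insert, Finset.mem_singleton, not_or] at hv
      rw [hl0 v (p v) (hp v).adj_sub, hφ, add_neg_cancel]
      · intro h
        rw [Sym2.eq_iff] at h
        tauto
      · intro h
        rw [Sym2.eq_iff] at h
        tauto
  have hcube := hfour (fun x => x ^ 3) (fun x => by ring)
  have hprod : (l c + l a) * (l c + l b) = 0 := by
    have hb' : l b = 1 - l a := by linarith
    have hd' : l d = -1 - l c := by linarith
    rw [hb', hd'] at hcube
    rw [hb']
    nlinarith
  -- normalise so that `l c = - l b` and `l d = - l a`
  wlog hcb : l c + l b = 0 generalizing c d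
  · have hca : l c + l a = 0 := by
      rcases mul_eq_zero.1 hprod with h | h
      · exact h
      · exact absurd h hcb
    have hsw : s(d, c) = s(c, d) := Sym2.eq_swap
    have := this d c
    rw [hsw] at this
    exact this hf hM1f.symm hM0f hne heq hl hl0 hcd.symm had hbc hac hbd (by linarith)
      (fun φ hφ => by have := hfour φ hφ; linarith) (by linarith)
      (by have : l d + l b = 0 := by linarith
          rw [this]; ring) (by linarith)
  have hda : l d + l a = 0 := by linarith
  have hcutE : ∀ u v, G.Adj u v → l u = 0 → l v ≠ 0 → s(u, v) = s(a, b) ∨ s(u, v) = s(c, d) := by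
    intro u v huv hu hv
    by_contra hcon
    push Not at hcon
    have := hl0 u v huv hcon.1 hcon.2
    apply hv
    rw [this, hu, neg_zero]
  have heq' : ∀ M : G.Subgraph, M.IsPerfectMatching → (M.Adj a b ↔ M.Adj c d) := heq
  have hnz : ∀ v, l v ≠ 0 := by
    intro w hw
    by_cases ha0 : l a = 0
    · have hb0 : l b ≠ 0 := by intro h; rw [ha0, h] at hla; norm_num at hla
      have hc0 : l c ≠ 0 := by intro h; apply hb0; linarith
      have hd0 : l d = 0 := by linarith
      refine no_two_cut G hB {v | l v = 0} (a := a) (b := b) (c := d) (d := c) ha0 hd0 hb0 hc0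
        hM1e.adj_sub (by rw [Sym2.eq_swap (a := d)]; exact hne.symm) ?_ ?_ M0 hM0 hM0e
      · intro u v hu hv huv
        have hu' : l u = 0 := hu
        have hv' : l v ≠ 0 := hv
        rcases hcutE u v huv hu' hv' with h | h <;> rw [Sym2.eq_iff] at h <;> grind
      · intro M hM
        rw [M.adj_comm d c]
        exact heq' M hM
    · have hd0 : l d ≠ 0 := by intro h; apply ha0; linarith
      by_cases hb0 : l b = 0
      · have hc0 : l c = 0 := by linarith
        refine no_two_cut G hB {v | l v = 0} (a := b) (b := a) (c := c) (d := d) hb0 hc0 ha0 hd0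
          hM1e.symm.adj_sub (by rw [Sym2.eq_swap (a := b)]; exact hne.symm) ?_ ?_ M0 hM0
          (fun h => hM0e h.symm)
        · intro u v hu hv huv
          have hu' : l u = 0 := hu
          have hv' : l v ≠ 0 := hv
          rcases hcutE u v huv hu' hv' with h | h <;> rw [Sym2.eq_iff] at h <;> grind
        · intro M hM
          rw [M.adj_comm b a]
          exact heq' M hM
      · have hc0 : l c ≠ 0 := by intro h; apply hb0; linarith
        obtain ⟨u, v, hu, hv, huv⟩ := exists_crossing hB.1.1 {v | l v = 0} (x := w) (y := a) hw ha0
        have hu' : l u = 0 := hu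
        rcases hcutE u v huv hu hv with h | h <;> rw [Sym2.eq_iff] at h <;> grind
  have hord : ∀ u v, G.Adj u v → s(u, v) ≠ s(a, b) → s(u, v) ≠ s(c, d) →
      ¬ (0 < l u ↔ 0 < l v) := by
    intro u v huv h1 h2
    have h3 := hl0 u v huv h1 h2
    have h4 := hnz u
    rw [h3, neg_pos]
    rcases lt_or_gt_of_ne h4 with h | h
    · simp [h, h.le]
    · simp [h, h.le]
  have hda' : l d = - l a := by linarith
  have hcb' : l c = - l b := by linarith
  have hpa := hnz a
  have hpb := hnz b
  have hiff : (0 < l c ↔ 0 < l d) ↔ (0 < l a ↔ 0 < l b) := by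
    rw [hda', hcb', neg_pos, neg_pos]
    rcases lt_or_gt_of_ne hpa with h | h <;> rcases lt_or_gt_of_ne hpb with h' | h' <;>
      simp [h, h', h.not_gt, h'.not_gt]
  have hmono : (0 < l a ↔ 0 < l b) := by
    by_contra hcon
    apply hB.2.1
    refine ⟨SimpleGraph.Coloring.mk (fun v => if 0 < l v then (0 : Fin 2) else 1) ?_⟩
    intro u v huv
    have key : ¬ (0 < l u ↔ 0 < l v) := by
      by_cases h1 : s(u, v) = s(a, b)
      · rw [Sym2.eq_iff] at h1
        rcases h1 with ⟨rfl, rfl⟩ | ⟨rfl, rfl⟩ <;> tauto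
      · by_cases h2 : s(u, v) = s(c, d)
        · rw [Sym2.eq_iff] at h2
          rcases h2 with ⟨rfl, rfl⟩ | ⟨rfl, rfl⟩ <;> tauto
        · exact hord u v huv h1 h2
    by_cases h1 : 0 < l u <;> by_cases h2 : 0 < l v <;> simp [h1, h2] at key ⊢
  refine ⟨fun v => 0 < l v, fun u v huv => ?_⟩
  constructor
  · intro h
    by_contra hcon
    push Not at hcon
    exact hord u v huv hcon.1 hcon.2 h
  · rintro (h | h) <;> rw [Sym2.eq_iff] at h <;> rcases h with ⟨rfl, rfl⟩ | ⟨rfl, rfl⟩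
    · exact hmono
    · exact hmono.symm
    · exact hiff.2 hmono
    · exact (hiff.2 hmono).symm

/-- A nonempty face `x_e = 0` yields a perfect matching avoiding `e`. -/
theorem exists_avoiding [Fintype V] (G : SimpleGraph V) {e : Sym2 V}
    (h : {x ∈ pmPolytope G | x e = 0}.Nonempty) :
    ∃ M : G.Subgraph, M.IsPerfectMatching ∧ e ∉ M.edgeSet := by
  by_contra hcon
  push Not at hcon
  obtain ⟨x, hx, hxe⟩ := h
  have hsub : pmPolytope G ⊆ {x | 1 ≤ (LinearMap.proj e : (Sym2 V → ℝ) →ₗ[ℝ] ℝ) x} := by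
    apply convexHull_min _ (convex_halfSpace_ge (LinearMap.isLinear _) 1)
    rintro _ ⟨M, hM, rfl⟩
    exact (incVecR_pos (hcon M hM)).ge
  have h1 : 1 ≤ x e := hsub hx
  rw [hxe] at h1
  norm_num at h1

/-- On a facet `x_e = 0`, an edge implying `e` is equivalent to `e`. -/
theorem facet_equiv [Fintype V] [DecidableEq V] (G : SimpleGraph V) (hG : MatchingCovered G)
    (hBvN : IsBvN G) {e f : Sym2 V} (hf : f ∈ G.edgeSet)
    (hfacet : {x ∈ pmPolytope G | x e = 0}.Nonempty ∧
      affDim {x ∈ pmPolytope G | x e = 0} = affDim (pmPolytope G) - 1)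
    (himp : ∀ M : G.Subgraph, M.IsPerfectMatching → f ∈ M.edgeSet → e ∈ M.edgeSet)
    (M : G.Subgraph) (hM : M.IsPerfectMatching) : e ∈ M.edgeSet ↔ f ∈ M.edgeSet := by
  refine ⟨fun hMe => ?_, himp M hM⟩
  by_contra hMf
  obtain ⟨M0, hM0, hM0e⟩ := exists_avoiding G hfacet.1
  have hM0f : f ∉ M0.edgeSet := fun h => hM0e (himp M0 hM0 h)
  obtain ⟨M1, hM1, hM1f⟩ := hG.2.2 f hf
  have hM1e := himp M1 hM1 hM1f
  have hle : pmPolytope G ⊆ {x | ((LinearMap.proj f : (Sym2 V → ℝ) →ₗ[ℝ] ℝ) -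
      (LinearMap.proj e : (Sym2 V → ℝ) →ₗ[ℝ] ℝ)) x ≤ 0} := by
    apply convexHull_min _ (convex_halfSpace_le (LinearMap.isLinear _) 0)
    rintro _ ⟨N, hN, rfl⟩
    simp only [Set.mem_ofPred_eq, LinearMap.sub_apply, LinearMap.proj_apply]
    by_cases h : f ∈ N.edgeSet
    · rw [incVecR_pos h, incVecR_pos (himp N hN h), sub_self]
    · rw [incVecR_neg h]
      have := incVecR_nonneg G N e
      linarith
  have hz : ∀ x ∈ pmPolytope G, x e = 0 → x f = 0 := by
    intro x hx hxe
    have h1 := hle hx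
    simp only [Set.mem_ofPred_eq, LinearMap.sub_apply, LinearMap.proj_apply] at h1
    have h2 : x ∈ bipRelaxation G := hBvN ▸ hx
    have h3 := h2.1 f
    linarith
  have hdim := hfacet.2
  unfold affDim at hdim
  rw [direction_affineSpan, direction_affineSpan] at hdim
  set DF := vectorSpan ℝ {x ∈ pmPolytope G | x e = 0} with hDF
  set D := vectorSpan ℝ (pmPolytope G) with hD
  let φ : (Sym2 V → ℝ) →ₗ[ℝ] ℝ × ℝ := (LinearMap.proj e).prod (LinearMap.proj f)
  have hDFD : DF ≤ D := vectorSpan_mono ℝ (fun x hx => hx.1)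
  have hDFk : DF ≤ LinearMap.ker φ := by
    rw [hDF, vectorSpan_def, Submodule.span_le]
    rintro _ ⟨x, hx, y, hy, rfl⟩
    have h1 := hz x hx.1 hx.2
    have h2 := hz y hy.1 hy.2
    have h3 : x e = 0 := hx.2
    have h4 : y e = 0 := hy.2
    simp [φ, h1, h2, h3, h4]
  have hv : incVecR G M1 - incVecR G M0 ∈ D :=
    vsub_mem_vectorSpan ℝ (incVecR_mem hM1) (incVecR_mem hM0)
  have hw : incVecR G M - incVecR G M0 ∈ D :=
    vsub_mem_vectorSpan ℝ (incVecR_mem hM) (incVecR_mem hM0)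
  have hsurj : LinearMap.range (φ.domRestrict D) = ⊤ := by
    rw [LinearMap.range_eq_top]
    rintro ⟨p, q⟩
    refine ⟨q • ⟨_, hv⟩ + (p - q) • ⟨_, hw⟩, ?_⟩
    simp [φ, LinearMap.domRestrict_apply, incVecR_pos hM1e, incVecR_pos hM1f, incVecR_neg hM0e,
      incVecR_neg hM0f, incVecR_pos hMe, incVecR_neg hMf]
  have hrank := LinearMap.finrank_range_add_finrank_ker (φ.domRestrict D)
  rw [hsurj, finrank_top, Module.finrank_prod, Module.finrank_self] at hrank
  have hker : DF.comap D.subtype ≤ LinearMap.ker (φ.domRestrict D) := by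
    intro x hx
    have := hDFk hx
    simpa using this
  have h1 := Submodule.finrank_mono hker
  rw [(Submodule.comapSubtypeEquivOfLe hDFD).finrank_eq] at h1
  omega

/-- A subgraph avoiding `e` as a subgraph of `G - e`. -/
def avoidSub {G : SimpleGraph V} {e : Sym2 V} (M : G.Subgraph) (h : e ∉ M.edgeSet) :
    (G.deleteEdges {e}).Subgraph where
  verts := M.verts
  Adj := M.Adj
  adj_sub := by
    intro a b hab
    rw [SimpleGraph.deleteEdges_adj]
    refine ⟨hab.adj_sub, fun hh => h ?_⟩
    rw [Set.mem_singleton_iff] at hh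
    rw [← hh]
    exact hab
  edge_vert := M.edge_vert
  symm := M.symm

theorem avoidSub_pm {G : SimpleGraph V} {e : Sym2 V} (M : G.Subgraph) (h : e ∉ M.edgeSet)
    (hM : M.IsPerfectMatching) : (avoidSub M h).IsPerfectMatching :=
  SimpleGraph.Subgraph.isPerfectMatching_iff.mpr (pm_exists_unique hM)

/-- If `e` is contained in one perfect matching and avoided by another, `G - e` is connected. -/
theorem connected_delete [Fintype V] (G : SimpleGraph V) (hG : MatchingCovered G) {e : Sym2 V}
    (he : e ∈ G.edgeSet) (M0 : G.Subgraph) (hM0 : M0.IsPerfectMatching) (hM0e : e ∉ M0.edgeSet) :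
    (G.deleteEdges {e}).Connected := by
  classical
  obtain ⟨v0⟩ := hG.1.nonempty
  rw [SimpleGraph.connected_iff_exists_forall_reachable]
  refine ⟨v0, ?_⟩
  by_contra hcon
  push Not at hcon
  obtain ⟨w, hw⟩ := hcon
  let X : Set V := {v | (G.deleteEdges {e}).Reachable v0 v}
  have hcl : ∀ u v, u ∈ X → v ∉ X → G.Adj u v → s(u, v) = e := by
    intro u v hu hv huv
    by_contra hne
    apply hv
    have : (G.deleteEdges {e}).Adj u v := by
      rw [SimpleGraph.deleteEdges_adj]
      exact ⟨huv, hne⟩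
    exact SimpleGraph.Reachable.trans hu this.reachable
  obtain ⟨a, b, ha, hb, hab⟩ := exists_crossing hG.1 X (x := v0) (y := w)
    (SimpleGraph.Reachable.refl _) hw
  have hE := hcl a b ha hb hab
  subst hE
  obtain ⟨M1, hM1, hM1e⟩ := hG.2.2 _ he
  rw [SimpleGraph.Subgraph.mem_edgeSet] at hM1e hM0e
  have h0 : Even X.ncard := by
    apply even_of_closed hM0
    intro u v hu huv
    by_contra hv
    have := hcl u v hu hv huv.adj_sub
    apply hM0e
    rw [← SimpleGraph.Subgraph.mem_edgeSet, ← this]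
    exact huv
  have h1 : Even (X \ {a}).ncard := by
    apply even_of_closed hM1
    rintro u v ⟨hu, hua⟩ huv
    refine ⟨?_, ?_⟩
    · by_contra hv
      have := hcl u v hu hv huv.adj_sub
      rw [Sym2.eq_iff] at this
      rcases this with ⟨rfl, _⟩ | ⟨rfl, _⟩
      · exact hua rfl
      · exact hb hu
    · rintro rfl
      have := (pm_exists_unique hM1 v).unique hM1e huv.symm
      subst this
      exact hb hu
  have h2 : (X \ {a}).ncard + 1 = X.ncard := Set.ncard_sdiff_singleton_add_one ha
  grind

end Helpers

/-- in a BvN brick, if `{x ∈ PM(G) : xₑ = 0}` is a facet then either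
`G - e` is matching covered, or there is a unique edge `e' ≠ e` with `G - e - e'`
bipartite such that every perfect matching contains `e` iff it contains `e'`. -/
theorem bvn_brick_facet_dichotomy [Fintype V] [DecidableEq V]
    (G : SimpleGraph V) (hBrick : IsBrick G) (hBvN : IsBvN G)
    (e : Sym2 V) (he : e ∈ G.edgeSet)
    (hfacet : {x ∈ pmPolytope G | x e = 0}.Nonempty ∧
      affDim {x ∈ pmPolytope G | x e = 0} = affDim (pmPolytope G) - 1) :
    MatchingCovered (G.deleteEdges {e}) ∨
      (∃! e' : Sym2 V, e' ∈ G.edgeSet ∧ e' ≠ e ∧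
        (G.deleteEdges {e, e'}).Colorable 2 ∧
        ∀ M : G.Subgraph, M.IsPerfectMatching →
          (e ∈ M.edgeSet ↔ e' ∈ M.edgeSet)) := by
  classical
  obtain ⟨M0, hM0, hM0e⟩ := exists_avoiding G hfacet.1
  have hMC := hBrick.1
  by_cases hall : ∀ f ∈ G.edgeSet, f ≠ e →
      ∃ M : G.Subgraph, M.IsPerfectMatching ∧ f ∈ M.edgeSet ∧ e ∉ M.edgeSet
  · left
    refine ⟨connected_delete G hMC he M0 hM0 hM0e, ?_, ?_⟩
    · obtain ⟨v⟩ := hMC.1.nonempty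
      obtain ⟨w, hw, _⟩ := pm_exists_unique (avoidSub_pm M0 hM0e hM0) v
      exact ⟨s(v, w), hw.adj_sub⟩
    · intro f hf
      rw [SimpleGraph.edgeSet_deleteEdges] at hf
      obtain ⟨M, hM, hMf, hMe⟩ := hall f hf.1 hf.2
      refine ⟨avoidSub M hMe, avoidSub_pm M hMe hM, ?_⟩
      induction f using Sym2.ind with | _ a b =>
      exact hMf
  · right
    push Not at hall
    obtain ⟨f, hf, hfe, himp⟩ := hall
    have heq := facet_equiv G hMC hBvN hf hfacet himp
    obtain ⟨c1, hc1⟩ := exists_coloring G hBrick hBvN he hf hfe heq M0 hM0 hM0e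
    refine ⟨f, ⟨hf, hfe, ?_, heq⟩, ?_⟩
    · refine ⟨SimpleGraph.Coloring.mk (fun v => if c1 v then (0 : Fin 2) else 1) ?_⟩
      intro u v huv
      rw [SimpleGraph.deleteEdges_adj] at huv
      have key := hc1 u v huv.1
      have h2 := huv.2
      simp only [Set.mem_insert_iff, Set.mem_singleton_iff] at h2
      by_cases h3 : c1 u <;> by_cases h4 : c1 v <;> simp [h3, h4] at key ⊢ <;> tauto
    · rintro g ⟨hg, hge, _, hgeq⟩
      by_contra hgf
      obtain ⟨c2, hc2⟩ := exists_coloring G hBrick hBvN he hg hge hgeq M0 hM0 hM0e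
      -- the cut separating agreement from disagreement of the two colourings is `{f, g}`
      have hcross : ∀ u v, G.Adj u v →
          (((c1 u ↔ c2 u) ↔ (c1 v ↔ c2 v)) ↔ (s(u, v) ≠ f ∧ s(u, v) ≠ g)) := by
        intro u v huv
        have h1 := hc1 u v huv
        have h2 := hc2 u v huv
        by_cases k1 : s(u, v) = e
        · have k2 : s(u, v) ≠ f := fun h => hfe (h ▸ k1)
          have k3 : s(u, v) ≠ g := fun h => hge (h ▸ k1)
          tauto
        · by_cases k2 : s(u, v) = f
          · have k3 : s(u, v) ≠ g := fun h => hgf (h ▸ k2)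
            tauto
          · tauto
      have hrep : ∀ h : Sym2 V, h ∈ G.edgeSet → h = f ∨ h = g →
          ∃ a b, h = s(a, b) ∧ (c1 a ↔ c2 a) ∧ ¬ (c1 b ↔ c2 b) := by
        intro h hh hor
        induction h using Sym2.ind with | _ a b =>
        have := hcross a b hh
        have hno : ¬ ((c1 a ↔ c2 a) ↔ (c1 b ↔ c2 b)) := fun k => by
          have k' := this.1 k
          rcases hor with h | h
          · exact k'.1 h
          · exact k'.2 h
        clear this
        by_cases ha : (c1 a ↔ c2 a)
        · exact ⟨a, b, rfl, ha, fun k => hno (iff_of_true ha k)⟩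
        · exact ⟨b, a, Sym2.eq_swap, by_contra fun k => hno (iff_of_false ha k), ha⟩
      obtain ⟨a, b, rfl, ha, hb⟩ := hrep f hf (Or.inl rfl)
      obtain ⟨c, d, rfl, hc, hd⟩ := hrep g hg (Or.inr rfl)
      refine no_two_cut G hBrick {v | c1 v ↔ c2 v} (a := a) (b := b) (c := c) (d := d) ha hc hb hd
        hf (Ne.symm hgf) ?_ ?_ M0 hM0 ?_
      · intro u v hu hv huv
        have hu' : c1 u ↔ c2 u := hu
        have hv' : ¬ (c1 v ↔ c2 v) := hv
        have hor : s(u, v) = s(a, b) ∨ s(u, v) = s(c, d) := by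
          by_contra hcon
          push Not at hcon
          exact hv' (((hcross u v huv).2 hcon).1 hu')
        rcases hor with h | h <;> rw [Sym2.eq_iff] at h <;> rcases h with ⟨rfl, rfl⟩ | ⟨rfl, rfl⟩
        · exact Or.inl ⟨rfl, rfl⟩
        · exact absurd ha hv'
        · exact Or.inr ⟨rfl, rfl⟩
        · exact absurd hc hv'
      · intro M hM
        exact (heq M hM).symm.trans (hgeq M hM)
      · intro h
        exact hM0e (himp M0 hM0 h)
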